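/- Let G be a finite simple graph, L a real number with L ≤ ρ*, and C the ⌈L⌉-core of G (the maximal vertex subset with min-degree at least ⌈L⌉). Then every densest subgraph S* of G satisfies S* ⊆ C; in particular, pruning G down to the ⌈L⌉-core for any lower bound L on ρ* preserves every densest subgraph. -/

import Mathlib

open Finset
open scoped Classical

variable {V : Type*}

/-- `degS G S v` is the degree of `v` in the subgraph of `G` induced by the vertex set `S`. -/
noncomputable def degS [Fintype V] (G : SimpleGraph V) (S : Finset V) (v : V) : ℕ :=
  (S.filter fun u => G.Adj v u).card

/-- `edgeCount G S` is the number of edges of the subgraph of `G` induced by `S`. -/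
noncomputable def edgeCount [Fintype V] (G : SimpleGraph V) (S : Finset V) : ℕ :=
  (G.edgeFinset.filter fun ed => ∀ v ∈ ed, v ∈ S).card

/-- `density G S` is the density `|E(G[S])| / |S|` of the induced subgraph `G[S]`, as a rational. -/
noncomputable def density [Fintype V] (G : SimpleGraph V) (S : Finset V) : ℚ :=
  (edgeCount G S : ℚ) / (S.card : ℚ)

lemma edgeCount_le_erase [Fintype V] (G : SimpleGraph V) (S : Finset V) (v : V) :
    edgeCount G S ≤ edgeCount G (S.erase v) + degS G S v := by
  unfold edgeCount degS
  have h : (G.edgeFinset.filter fun ed => ∀ w ∈ ed, w ∈ S) ⊆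
      (G.edgeFinset.filter fun ed => ∀ w ∈ ed, w ∈ S.erase v) ∪
        (S.filter fun u => G.Adj v u).image (fun u => s(v, u)) := by
    intro e he
    rw [Finset.mem_filter] at he
    obtain ⟨he, hS⟩ := he
    rw [Finset.mem_union]
    by_cases hv : v ∈ e
    · right
      obtain ⟨u, rfl⟩ := hv
      rw [Finset.mem_image]
      refine ⟨u, ?_, rfl⟩
      rw [Finset.mem_filter]
      exact ⟨hS u (Sym2.mem_mk_right v u), by simpa using he⟩
    · left
      rw [Finset.mem_filter]
      refine ⟨he, fun w hw => Finset.mem_erase.2 ⟨?_, hS w hw⟩⟩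
      rintro rfl
      exact hv hw
  exact (Finset.card_le_card h).trans ((Finset.card_union_le _ _).trans
    (Nat.add_le_add_left Finset.card_image_le _))

lemma edgeCount_empty' [Fintype V] (G : SimpleGraph V) : edgeCount G ∅ = 0 := by
  unfold edgeCount
  rw [Finset.card_eq_zero, Finset.filter_eq_empty_iff]
  intro e _ h
  induction e with
  | h a b => exact absurd (h a (Sym2.mem_mk_left a b)) (Finset.notMem_empty a)

lemma degS_mono [Fintype V] (G : SimpleGraph V) {S T : Finset V} (h : S ⊆ T) (v : V) :
    degS G S v ≤ degS G T v :=
  Finset.card_le_card (Finset.filter_subset_filter _ h)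

lemma density_le_degS [Fintype V] (G : SimpleGraph V) (S : Finset V)
    (hmax : ∀ T : Finset V, T.Nonempty → density G T ≤ density G S) (v : V) (hv : v ∈ S) :
    density G S ≤ (degS G S v : ℚ) := by
  have hpos : (0 : ℚ) < S.card := by exact_mod_cast Finset.card_pos.2 ⟨v, hv⟩
  have h1 : (edgeCount G S : ℚ) = density G S * S.card := by
    unfold density
    field_simp
  have h2 : (edgeCount G (S.erase v) : ℚ) ≤ density G S * (S.erase v).card := by
    rcases (S.erase v).eq_empty_or_nonempty with h | h
    · rw [h, edgeCount_empty']; simp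
    · have hp : (0 : ℚ) < (S.erase v).card := by exact_mod_cast Finset.card_pos.2 h
      have := hmax _ h
      conv_lhs at this => unfold density
      exact (div_le_iff₀ hp).1 this
  have h3 : ((S.erase v).card : ℚ) + 1 = S.card := by
    exact_mod_cast Finset.card_erase_add_one hv
  have h4 : (edgeCount G S : ℚ) ≤ edgeCount G (S.erase v) + degS G S v := by
    exact_mod_cast edgeCount_le_erase G S v
  rw [h1, ← h3] at h4
  linarith

/-- Pruning to the `⌈L⌉`-core for any lower bound `L ≤ ρ*` preserves every densest
subgraph: if `C` is the maximal subset with min-degree at least `⌈L⌉`, then every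
densest subgraph `Sstar` with `L ≤ ρ(Sstar)` satisfies `Sstar ⊆ C`. -/
theorem densest_subgraph_subset_ceil_core
    [Fintype V] (G : SimpleGraph V) (L : ℝ)
    (C : Finset V) (hC : ∀ v ∈ C, ⌈L⌉ ≤ (degS G C v : ℤ))
    (hCmax : ∀ T : Finset V, (∀ v ∈ T, ⌈L⌉ ≤ (degS G T v : ℤ)) → C ⊆ T → T = C) :
    ∀ Sstar : Finset V, Sstar.Nonempty →
      (∀ S : Finset V, S.Nonempty → density G S ≤ density G Sstar) →
      L ≤ ((density G Sstar : ℚ) : ℝ) → Sstar ⊆ C := by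
  intro S _ hmax hL
  have hdeg : ∀ v ∈ S, ⌈L⌉ ≤ (degS G S v : ℤ) := by
    intro v hv
    rw [Int.ceil_le]
    have h : ((density G S : ℚ) : ℝ) ≤ ((degS G S v : ℚ) : ℝ) :=
      Rat.cast_le.2 (density_le_degS G S hmax v hv)
    push_cast at h ⊢
    exact hL.trans h
  have hU : C ∪ S = C := by
    refine hCmax (C ∪ S) ?_ Finset.subset_union_left
    intro v hv
    rcases Finset.mem_union.1 hv with h | h
    · exact (hC v h).trans (by exact_mod_cast degS_mono G Finset.subset_union_left v)
    · exact (hdeg v h).trans (by exact_mod_cast degS_mono G Finset.subset_union_right v)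
  exact Finset.union_eq_left.1 hU
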